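/- Let S be a compact convex subset of ℝ² with affine hull ℝ². Then S is affinely isomorphic to a triangle or to the closed unit disk if and only if the group of bijective affine transformations of S acts transitively on the extreme points of S and S is distinguishably decomposable. -/

import Mathlib

noncomputable section

/-- `S` is affinely isomorphic to `T`: there is a bijective affine map from `S` onto `T`. -/
def AffIso {E F : Type*} [NormedAddCommGroup E] [NormedSpace ℝ E]
    [NormedAddCommGroup F] [NormedSpace ℝ F] (S : Set E) (T : Set F) : Prop :=
  ∃ f : E →ᵃ[ℝ] F, Set.InjOn f S ∧ f '' S = T

/-- The group of bijective affine transformations of `S` acts transitively on the set of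
extreme points of `S`. -/
def AutTransitiveOnExtreme {E : Type*} [NormedAddCommGroup E] [NormedSpace ℝ E]
    (S : Set E) : Prop :=
  ∀ x ∈ Set.extremePoints ℝ S, ∀ y ∈ Set.extremePoints ℝ S,
    ∃ f : E ≃ᵃ[ℝ] E, f '' S = S ∧ f x = y

/-- The points `s 0, …, s (k-1)` of the convex set `S` are distinguishable: there are affine
functionals `e i` that are nonnegative on `S`, sum to `1` on `S`, and satisfy `e i (s i) = 1`. -/
def Distinguishable {E : Type*} [NormedAddCommGroup E] [NormedSpace ℝ E]
    (S : Set E) {k : ℕ} (s : Fin k → E) : Prop :=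
  ∃ e : Fin k → (E →ᵃ[ℝ] ℝ),
    (∀ i, ∀ x ∈ S, 0 ≤ e i x) ∧ (∀ x ∈ S, ∑ i, e i x = 1) ∧ (∀ i, e i (s i) = 1)

/-- `S` is distinguishably decomposable: every point of `S` is a finite convex combination of
distinguishable extreme points of `S`. -/
def DistinguishablyDecomposable {E : Type*} [NormedAddCommGroup E] [NormedSpace ℝ E]
    (S : Set E) : Prop :=
  ∀ x ∈ S, ∃ (k : ℕ) (s : Fin k → E) (l : Fin k → ℝ),
    0 < k ∧ (∀ j, s j ∈ Set.extremePoints ℝ S) ∧ Distinguishable S s ∧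
    (∀ j, 0 ≤ l j) ∧ (∑ j, l j = 1) ∧ (∑ j, l j • s j = x)

namespace AffineEquiv

variable {E F : Type*} [AddCommGroup E] [Module ℝ E] [AddCommGroup F] [Module ℝ F]

theorem image_extremePoints (g : E ≃ᵃ[ℝ] F) (S : Set E) :
    g '' Set.extremePoints ℝ S = Set.extremePoints ℝ (g '' S) := by
  ext b
  obtain ⟨a, rfl⟩ := g.surjective b
  have himage : ∀ x y, g '' openSegment ℝ x y = openSegment ℝ (g x) (g y) :=
    image_openSegment _ g.toAffineMap
  simp only [mem_extremePoints, g.surjective.forall, g.injective.mem_set_image,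
    g.injective.eq_iff, ← himage]

theorem symm_image_image (g : E ≃ᵃ[ℝ] F) (S : Set E) : g.symm '' (g '' S) = S := by
  simp [Set.image_image]

end AffineEquiv

theorem AffineMap.apply_sum_smul {ι E F : Type*} [Fintype ι] [AddCommGroup E] [Module ℝ E]
    [AddCommGroup F] [Module ℝ F] (g : E →ᵃ[ℝ] F) {l : ι → ℝ} (hl : ∑ j, l j = 1) (s : ι → E) :
    g (∑ j, l j • s j) = ∑ j, l j • g (s j) := by
  have hg : ∀ x, g x = g.linear x + g 0 := fun x => by simpa using g.map_vadd 0 x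
  rw [hg, map_sum]
  simp_rw [hg (s _), smul_add, Finset.sum_add_distrib, ← Finset.sum_smul, hl, map_smul, one_smul]

section Transfer

variable {E F : Type*} [NormedAddCommGroup E] [NormedSpace ℝ E]
  [NormedAddCommGroup F] [NormedSpace ℝ F] {S : Set E}

theorem AutTransitiveOnExtreme.image (h : AutTransitiveOnExtreme S) (g : E ≃ᵃ[ℝ] F) :
    AutTransitiveOnExtreme (g '' S) := by
  intro x hx y hy
  rw [← g.image_extremePoints] at hx hy
  obtain ⟨x, hx, rfl⟩ := hx
  obtain ⟨y, hy, rfl⟩ := hy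
  obtain ⟨f, hf, rfl⟩ := h x hx y hy
  refine ⟨(g.symm.trans f).trans g, ?_, by simp⟩
  conv_rhs => rw [← hf]
  simp [Set.image_image]

theorem Distinguishable.image {k : ℕ} {s : Fin k → E} (h : Distinguishable S s)
    (g : E ≃ᵃ[ℝ] F) : Distinguishable (g '' S) (g ∘ s) := by
  obtain ⟨e, hnonneg, hsum, hone⟩ := h
  refine ⟨fun i => (e i).comp g.symm.toAffineMap, ?_, ?_, ?_⟩
  · rintro i _ ⟨x, hx, rfl⟩
    simpa using hnonneg i x hx
  · rintro _ ⟨x, hx, rfl⟩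
    simpa using hsum x hx
  · simpa using hone

theorem DistinguishablyDecomposable.image (h : DistinguishablyDecomposable S) (g : E ≃ᵃ[ℝ] F) :
    DistinguishablyDecomposable (g '' S) := by
  rintro _ ⟨x, hx, rfl⟩
  obtain ⟨k, s, l, hk, hext, hdist, hl, hl1, rfl⟩ := h x hx
  refine ⟨k, g ∘ s, l, hk, fun j => ?_, hdist.image g, hl, hl1, ?_⟩
  · rw [← g.image_extremePoints]
    exact Set.mem_image_of_mem _ (hext j)
  · exact (g.toAffineMap.apply_sum_smul hl1 s).symm

/-- An affine isomorphism from a set with nonempty interior extends to an affine equivalence of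
the ambient spaces if these have the same finite dimension. -/
theorem AffIso.exists_affineEquiv [FiniteDimensional ℝ E] [FiniteDimensional ℝ F] {T : Set F}
    (h : AffIso S T) (hS : (interior S).Nonempty)
    (hdim : Module.finrank ℝ E = Module.finrank ℝ F) : ∃ g : E ≃ᵃ[ℝ] F, g '' S = T := by
  obtain ⟨f, hinj, rfl⟩ := h
  obtain ⟨x, hx⟩ := hS
  have hlin : Function.Injective f.linear := by
    rw [injective_iff_map_eq_zero]
    intro v hv
    have hcont : Continuous fun t : ℝ => x + t • v := by fun_prop
    have hnear : ∀ᶠ t in nhds (0 : ℝ), x + t • v ∈ interior S :=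
      hcont.continuousAt.eventually_mem (isOpen_interior.mem_nhds (by simpa using hx))
    obtain ⟨t, htS, ht⟩ :=
      ((hnear.filter_mono nhdsWithin_le_nhds).and (self_mem_nhdsWithin (s := {0}ᶜ))).exists
    have heq : f (x + t • v) = f x := by
      have := f.map_vadd x (t • v)
      simpa [hv, add_comm] using this
    have ht : t ≠ 0 := ht
    simpa [ht] using hinj (interior_subset htS) (interior_subset hx) heq
  have hbij : Function.Bijective f := by
    rw [← f.linear_bijective_iff]
    exact ⟨hlin, (LinearMap.injective_iff_surjective_of_finrank_eq_finrank hdim).1 hlin⟩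
  exact ⟨AffineEquiv.ofBijective hbij, rfl⟩

end Transfer

section Simplex

variable {E : Type*} [NormedAddCommGroup E] [NormedSpace ℝ E] {ι : Type*}

/-- The affine involution exchanging two vertices of an affine basis. -/
def AffineBasis.swapMap (b : AffineBasis ι ℝ E) (i j : ι) : E →ᵃ[ℝ] E :=
  AffineMap.id ℝ E +
    (LinearMap.toSpanSingleton ℝ E (b j - b i)).toAffineMap.comp (b.coord i - b.coord j)

theorem AffineBasis.swapMap_apply [DecidableEq ι] (b : AffineBasis ι ℝ E) (i j k : ι) :
    b.swapMap i j (b k) = b (Equiv.swap i j k) := by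
  simp only [swapMap, AffineMap.coe_add, Pi.add_apply, AffineMap.id_apply, AffineMap.coe_comp,
    Function.comp_apply, LinearMap.coe_toAffineMap, AffineMap.coe_sub, Pi.sub_apply,
    LinearMap.toSpanSingleton_apply, b.coord_apply, Equiv.swap_apply_def]
  rcases eq_or_ne k i with rfl | hki
  · rcases eq_or_ne j k with rfl | hjk <;> simp [*]
  · rcases eq_or_ne k j with rfl | hkj
    · simp [hki, hki.symm]
    · simp [hki, hkj, hki.symm, hkj.symm]

theorem AffineBasis.swapMap_involutive (b : AffineBasis ι ℝ E) (i j : ι) :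
    Function.Involutive (b.swapMap i j) := by
  classical
  have : (b.swapMap i j).comp (b.swapMap i j) = AffineMap.id ℝ E := by
    refine AffineMap.ext_on b.tot ?_
    rintro _ ⟨k, rfl⟩
    simp [b.swapMap_apply]
  exact fun x => congrArg (fun f : E →ᵃ[ℝ] E => f x) this

theorem AffineBasis.autTransitiveOnExtreme_convexHull (b : AffineBasis ι ℝ E) :
    AutTransitiveOnExtreme (convexHull ℝ (Set.range b)) := by
  classical
  intro x hx y hy
  obtain ⟨i, rfl⟩ := extremePoints_convexHull_subset hx
  obtain ⟨j, rfl⟩ := extremePoints_convexHull_subset hy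
  refine ⟨AffineEquiv.ofBijective (b.swapMap_involutive i j).bijective, ?_, ?_⟩
  · change b.swapMap i j '' _ = _
    rw [AffineMap.image_convexHull, ← Set.range_comp]
    have : b.swapMap i j ∘ b = b ∘ Equiv.swap i j := funext (b.swapMap_apply i j)
    rw [this, (Equiv.swap i j).surjective.range_comp]
  · simp [b.swapMap_apply]

theorem AffineBasis.mem_extremePoints_convexHull [Finite ι] (b : AffineBasis ι ℝ E) (i : ι) :
    b i ∈ Set.extremePoints ℝ (convexHull ℝ (Set.range b)) := by
  classical
  rw [mem_extremePoints_iff_left]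
  refine ⟨subset_convexHull ℝ _ ⟨i, rfl⟩, fun x hx y hy hxy => ?_⟩
  rw [b.convexHull_eq_nonneg_coord] at hx hy
  have hzero : ∀ j ≠ i, b.coord j x = 0 := by
    intro j hj
    have := Set.mem_image_of_mem (b.coord j) hxy
    rw [image_openSegment] at this
    obtain ⟨s, t, hs, ht, hst, h⟩ := this
    rw [b.coord_apply_ne hj, smul_eq_mul, smul_eq_mul] at h
    have h2 := mul_nonneg hs.le (hx j)
    have h3 := mul_nonneg ht.le (hy j)
    have : s * b.coord j x = 0 := by linarith
    exact (mul_eq_zero.1 this).resolve_left hs.ne'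
  have := Fintype.ofFinite ι
  have hone : b.coord i x = 1 := by
    rw [← b.sum_coord_apply_eq_one x]
    exact (Finset.sum_eq_single i (fun j _ hj => hzero j hj) (by simp)).symm
  refine b.ext_elem fun j => ?_
  rw [b.coord_apply]
  split_ifs with h
  · rw [h, hone]
  · exact hzero j h

theorem AffineBasis.distinguishablyDecomposable_convexHull {n : ℕ}
    (b : AffineBasis (Fin n) ℝ E) : DistinguishablyDecomposable (convexHull ℝ (Set.range b)) := by
  intro x hx
  have hpos : 0 < n := Fin.pos_iff_nonempty.2 b.nonempty
  refine ⟨n, b, fun i => b.coord i x, hpos, b.mem_extremePoints_convexHull,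
    ⟨b.coord, fun i y hy => ?_, fun y _ => b.sum_coord_apply_eq_one y, b.coord_apply_eq⟩,
    fun i => ?_, b.sum_coord_apply_eq_one x, b.linear_combination_coord_eq_self x⟩
  · rw [b.convexHull_eq_nonneg_coord] at hy
    exact hy i
  · rw [b.convexHull_eq_nonneg_coord] at hx
    exact hx i

theorem Distinguishable.apply_eq_zero {S : Set E} {k : ℕ} {s : Fin k → E} {e : Fin k → E →ᵃ[ℝ] ℝ}
    (hs : ∀ j, s j ∈ S) (hnonneg : ∀ i, ∀ x ∈ S, 0 ≤ e i x) (hsum : ∀ x ∈ S, ∑ i, e i x = 1)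
    (hone : ∀ i, e i (s i) = 1) {i j : Fin k} (hij : i ≠ j) : e i (s j) = 0 := by
  have h := hsum (s j) (hs j)
  rw [← Finset.add_sum_erase _ _ (Finset.mem_univ j), hone, add_eq_left,
    Finset.sum_eq_zero_iff_of_nonneg fun i _ => hnonneg i _ (hs j)] at h
  exact h i (by simp [hij])

theorem Distinguishable.affineIndependent {S : Set E} {k : ℕ} {s : Fin k → E}
    (h : Distinguishable S s) (hs : ∀ j, s j ∈ S) : AffineIndependent ℝ s := by
  obtain ⟨e, hnonneg, hsum, hone⟩ := h
  rw [affineIndependent_iff]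
  intro t w hw hws i hi
  have hlin : (e i).linear (∑ j ∈ t, w j • s j) + (∑ j ∈ t, w j) * e i 0 = w i := by
    rw [map_sum, Finset.sum_mul, ← Finset.sum_add_distrib, Finset.sum_eq_single_of_mem i hi]
    · have := (e i).map_vadd 0 (s i)
      simp only [vadd_eq_add, add_zero, hone] at this
      rw [map_smul, smul_eq_mul, ← mul_add, ← this, mul_one]
    · intro j _ hj
      have := (e i).map_vadd 0 (s j)
      simp only [vadd_eq_add, add_zero] at this
      rw [map_smul, smul_eq_mul, ← mul_add, ← this,
        Distinguishable.apply_eq_zero hs hnonneg hsum hone hj.symm, mul_zero]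
  simpa [hw, hws] using hlin.symm

/-- A convex set containing a maximal family of distinguishable points is their convex hull. -/
theorem Distinguishable.eq_convexHull {S : Set E} (hS : Convex ℝ S) {k : ℕ} {s : Fin k → E}
    (h : Distinguishable S s) (hs : ∀ j, s j ∈ S) (htot : affineSpan ℝ (Set.range s) = ⊤) :
    S = convexHull ℝ (Set.range s) := by
  refine Set.Subset.antisymm ?_ (convexHull_min (Set.range_subset_iff.2 hs) hS)
  let b : AffineBasis (Fin k) ℝ E := ⟨s, h.affineIndependent hs, htot⟩
  obtain ⟨e, hnonneg, hsum, hone⟩ := h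
  intro x hx
  change x ∈ convexHull ℝ (Set.range b)
  rw [b.convexHull_eq_nonneg_coord]
  intro i
  have : b.coord i = e i := by
    refine AffineMap.ext_on b.tot ?_
    rintro _ ⟨j, rfl⟩
    rw [b.coord_apply]
    split_ifs with hij
    · rw [hij]
      exact (hone j).symm
    · exact (Distinguishable.apply_eq_zero hs hnonneg hsum hone hij).symm
  rw [this]
  exact hnonneg i x hx

end Simplex

section Ball

variable {E : Type*} [NormedAddCommGroup E] [InnerProductSpace ℝ E] [Nontrivial E]

theorem autTransitiveOnExtreme_closedBall :
    AutTransitiveOnExtreme (Metric.closedBall (0 : E) 1) := by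
  intro x hx y hy
  rw [StrictConvexSpace.extremePoints_closedBall_eq_sphere, mem_sphere_zero_iff_norm] at hx hy
  refine ⟨(Submodule.reflection (Submodule.span ℝ {x - y})ᗮ).toAffineIsometryEquiv.toAffineEquiv,
    ?_, Submodule.reflection_sub (hx.trans hy.symm)⟩
  simp

theorem distinguishablyDecomposable_closedBall :
    DistinguishablyDecomposable (Metric.closedBall (0 : E) 1) := by
  intro x hx
  rw [mem_closedBall_zero_iff] at hx
  obtain ⟨u, hu, hxu⟩ : ∃ u : E, ‖u‖ = 1 ∧ ‖x‖ • u = x := by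
    rcases eq_or_ne x 0 with rfl | hx0
    · obtain ⟨u, hu⟩ := exists_norm_eq E zero_le_one
      exact ⟨u, hu, by simp⟩
    · exact ⟨‖x‖⁻¹ • x, by simp [norm_smul, hx0], by simp [smul_smul, hx0]⟩
  have hle : ∀ y : E, ‖y‖ ≤ 1 → |inner ℝ u y| ≤ 1 := fun y hy =>
    (abs_real_inner_le_norm u y).trans (by rw [hu, one_mul]; exact hy)
  let φ : E →ᵃ[ℝ] ℝ := (innerₗ E u).toAffineMap
  have hφ : ∀ y, φ y = inner ℝ u y := fun y => rfl
  let c : E →ᵃ[ℝ] ℝ := AffineMap.const ℝ E (2⁻¹ : ℝ)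
  have hc : ∀ y, c y = 2⁻¹ := fun y => rfl
  refine ⟨2, ![u, -u], ![(1 + ‖x‖) / 2, (1 - ‖x‖) / 2], two_pos, ?_,
    ⟨![c + (2⁻¹ : ℝ) • φ, c - (2⁻¹ : ℝ) • φ], ?_, ?_, ?_⟩, ?_, ?_, ?_⟩
  · rw [StrictConvexSpace.extremePoints_closedBall_eq_sphere]
    simp [Fin.forall_fin_two, hu]
  · simp only [Fin.forall_fin_two, mem_closedBall_zero_iff]
    constructor <;>
    · intro y hy
      have := abs_le.1 (hle y hy)
      simp [hφ, hc]
      linarith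
  · intro y _
    simp [Fin.sum_univ_two, hφ, hc]
    norm_num
  · simp [Fin.forall_fin_two, hφ, hc, hu]
    norm_num
  · simp only [Fin.forall_fin_two, Matrix.cons_val_zero, Matrix.cons_val_one]
    constructor <;> linarith [norm_nonneg x]
  · simp [Fin.sum_univ_two]
    ring
  · simp only [Fin.sum_univ_two, Matrix.cons_val_zero, Matrix.cons_val_one]
    conv_rhs => rw [← hxu]
    module

end Ball

section Rotation

open scoped Pointwise

/-- The orbit of a point under the linear isometries preserving a plane set is finite once only
finitely many rotations preserve the set. -/
theorem finite_setOf_isometry_apply {S : Set ℂ}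
    (hfin : (MulAction.stabilizer Circle S : Set Circle).Finite) (x : ℂ) :
    {y | ∃ L : ℂ ≃ₗᵢ[ℝ] ℂ, L '' S = S ∧ L x = y}.Finite := by
  have horbit : ∀ w : ℂ, ((fun u : Circle => u • w) '' MulAction.stabilizer Circle S).Finite :=
    fun w => hfin.image _
  by_cases hrefl : ∃ a : Circle, (Complex.conjLIE.trans (rotation a)) '' S = S
  · obtain ⟨a, ha⟩ := hrefl
    refine ((horbit x).union (horbit ((Complex.conjLIE.trans (rotation a)) x))).subset ?_
    rintro _ ⟨L, hL, rfl⟩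
    obtain ⟨b, rfl | rfl⟩ := linear_isometry_complex L
    · exact Or.inl ⟨b, hL, rfl⟩
    · have hcomp : ∀ z, (Complex.conjLIE.trans (rotation b)) z =
          (b * a⁻¹) • (Complex.conjLIE.trans (rotation a)) z := by
        intro z
        change b • Complex.conjLIE z = (b * a⁻¹) • a • Complex.conjLIE z
        rw [smul_smul, inv_mul_cancel_right]
      refine Or.inr ⟨b * a⁻¹, ?_, (hcomp x).symm⟩
      calc (b * a⁻¹) • S = (b * a⁻¹) • ((Complex.conjLIE.trans (rotation a)) '' S) := by rw [ha]
        _ = (Complex.conjLIE.trans (rotation b)) '' S := by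
          change (fun z => (b * a⁻¹) • z) '' _ = _
          rw [Set.image_image]
          exact Set.image_congr fun z _ => (hcomp z).symm
        _ = S := hL
  · refine (horbit x).subset ?_
    rintro _ ⟨L, hL, rfl⟩
    obtain ⟨b, rfl | rfl⟩ := linear_isometry_complex L
    · exact ⟨b, hL, rfl⟩
    · exact absurd ⟨b, hL⟩ hrefl

theorem finite_or_dense_angles (K : Subgroup Circle) :
    (K : Set Circle).Finite ∨ Dense {θ : ℝ | Circle.exp θ ∈ K} := by
  let H : AddSubgroup ℝ := (Subgroup.toAddSubgroup K).comap Circle.expHom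
  have hH : ∀ θ, θ ∈ H ↔ Circle.exp θ ∈ K := fun θ => Iff.rfl
  rcases H.dense_or_cyclic with hdense | ⟨a, ha⟩
  · exact Or.inr hdense
  · left
    rw [← AddSubgroup.zmultiples_eq_closure] at ha
    have hpi : 2 * Real.pi ∈ H := by
      rw [hH, Circle.exp_two_pi]
      exact one_mem K
    rw [ha, AddSubgroup.mem_zmultiples_iff] at hpi
    obtain ⟨n, hn⟩ := hpi
    have hexp : ∀ m : ℤ, Circle.exp (m • a) = Circle.exp a ^ m := fun m =>
      congrArg Additive.toMul (map_zsmul Circle.expHom m a)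
    have hord : IsOfFinOrder (Circle.exp a) := by
      rw [isOfFinOrder_iff_zpow_eq_one]
      refine ⟨n, ?_, by rw [← hexp, hn, Circle.exp_two_pi]⟩
      rintro rfl
      simp [Real.pi_ne_zero] at hn
    refine (finite_zpowers.2 hord).subset fun u hu => ?_
    obtain ⟨θ, rfl⟩ : ∃ θ, Circle.exp θ = u := ⟨_, Circle.exp_arg u⟩
    have : θ ∈ H := hu
    rw [ha, AddSubgroup.mem_zmultiples_iff] at this
    obtain ⟨m, rfl⟩ := this
    rw [hexp]
    exact ⟨m, rfl⟩

theorem exists_eq_closedBall_of_isometries {S : Set ℂ} (hcomp : IsCompact S) (hconv : Convex ℝ S)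
    (hinf : (Set.extremePoints ℝ S).Infinite)
    (htrans : ∀ x ∈ Set.extremePoints ℝ S, ∀ y ∈ Set.extremePoints ℝ S,
      ∃ L : ℂ ≃ₗᵢ[ℝ] ℂ, L '' S = S ∧ L x = y) :
    ∃ r, 0 < r ∧ S = Metric.closedBall 0 r := by
  obtain ⟨x, hx, hx0⟩ := hinf.exists_notMem_finset {0}
  rw [Finset.mem_singleton] at hx0
  have hpos : 0 < ‖x‖ := norm_pos_iff.2 hx0
  refine ⟨‖x‖, hpos, Set.Subset.antisymm ?_ ?_⟩
  · rw [← closure_convexHull_extremePoints hcomp hconv]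
    refine closure_minimal (convexHull_min (fun y hy => ?_) (convex_closedBall 0 _))
      Metric.isClosed_closedBall
    obtain ⟨L, -, rfl⟩ := htrans x hx y hy
    simp
  · have hdense : Dense {θ : ℝ | Circle.exp θ ∈ MulAction.stabilizer Circle S} :=
      (finite_or_dense_angles _).resolve_left fun hfin =>
        hinf ((finite_setOf_isometry_apply hfin x).subset (htrans x hx))
    have hmem : ∀ θ : ℝ, Circle.exp θ • x ∈ S := by
      have hcont : Continuous fun θ : ℝ => Circle.exp θ • x := by fun_prop
      intro θ
      refine hcomp.isClosed.closure_subset_iff.2 ?_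
        (hcont.range_subset_closure_image_dense hdense ⟨θ, rfl⟩)
      rintro _ ⟨t, ht, rfl⟩
      have ht : Circle.exp t • S = S := ht
      rw [← ht]
      exact Set.smul_mem_smul_set hx.1
    rw [← convexHull_sphere_eq_closedBall 0 hpos.le]
    refine convexHull_min (fun z hz => ?_) hconv
    rw [mem_sphere_zero_iff_norm] at hz
    let u : Circle := ⟨z / x, by simp [Submonoid.unitSphere, hz, hx0]⟩
    have hu : u • x = z := div_mul_cancel₀ z hx0
    rw [← hu, ← Circle.exp_arg u]
    exact hmem _

end Rotation

section Invariants

open MeasureTheory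
open scoped Pointwise

theorem measureReal_pos_of_interior_nonempty {V : Type*} [TopologicalSpace V] [MeasurableSpace V]
    {μ : Measure V} [IsFiniteMeasureOnCompacts μ] [μ.IsOpenPosMeasure] {S : Set V}
    (hcomp : IsCompact S) (hint : (interior S).Nonempty) : 0 < μ.real S :=
  ENNReal.toReal_pos (Measure.measure_pos_of_nonempty_interior μ hint).ne' hcomp.measure_lt_top.ne

section Centroid

variable {V : Type*} [NormedAddCommGroup V] [NormedSpace ℝ V] [FiniteDimensional ℝ V]

theorem AffineEquiv.hasFDerivAt (f : V ≃ᵃ[ℝ] V) (x : V) :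
    HasFDerivAt f (LinearMap.toContinuousLinearMap (f.linear : V →ₗ[ℝ] V)) x := by
  have hf : (f : V → V) =
      fun y => LinearMap.toContinuousLinearMap (f.linear : V →ₗ[ℝ] V) y + f 0 := by
    ext y
    simpa using f.map_vadd 0 y
  rw [hf]
  exact (ContinuousLinearMap.hasFDerivAt _).add_const _

variable {S : Set V} {f : V ≃ᵃ[ℝ] V}

theorem AffineEquiv.abs_det_linear_eq_one (hcomp : IsCompact S) (hint : (interior S).Nonempty)
    (hf : f '' S = S) : |LinearMap.det (f.linear : V →ₗ[ℝ] V)| = 1 := by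
  borelize V
  let μ : Measure V := Measure.addHaar
  have h := integral_image_eq_integral_abs_det_fderiv_smul μ hcomp.measurableSet
    (fun x _ => (f.hasFDerivAt x).hasFDerivWithinAt) f.injective.injOn (fun _ => (1 : ℝ))
  rw [hf] at h
  have hpos : 0 < μ.real S := measureReal_pos_of_interior_nonempty hcomp hint
  simp only [integral_const, smul_eq_mul, mul_one, measureReal_restrict_apply_univ] at h
  exact (mul_eq_left₀ hpos.ne').1 h.symm

variable [MeasurableSpace V] [BorelSpace V] {μ : Measure V} [μ.IsAddHaarMeasure]

theorem setIntegral_comp_affineEquiv (hcomp : IsCompact S) (hint : (interior S).Nonempty)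
    (hf : f '' S = S) {F : Type*} [NormedAddCommGroup F] [NormedSpace ℝ F] (g : V → F) :
    ∫ x in S, g (f x) ∂μ = ∫ x in S, g x ∂μ := by
  have h := integral_image_eq_integral_abs_det_fderiv_smul μ hcomp.measurableSet
    (fun x _ => (f.hasFDerivAt x).hasFDerivWithinAt) f.injective.injOn g
  have hdet : |(LinearMap.toContinuousLinearMap (f.linear : V →ₗ[ℝ] V)).det| = 1 :=
    f.abs_det_linear_eq_one hcomp hint hf
  simpa only [hf, hdet, one_smul] using h.symm

theorem apply_average_eq (hcomp : IsCompact S) (hint : (interior S).Nonempty) (hf : f '' S = S) :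
    f (⨍ x in S, x ∂μ) = ⨍ x in S, x ∂μ := by
  have hpos : 0 < μ.real S := measureReal_pos_of_interior_nonempty hcomp hint
  obtain ⟨L, c, hdecomp⟩ : ∃ (L : V →L[ℝ] V) (c : V), ∀ y, f y = L y + c := by
    refine ⟨LinearMap.toContinuousLinearMap (f.linear : V →ₗ[ℝ] V), f 0, fun y => ?_⟩
    simpa using f.map_vadd 0 y
  have hid : IntegrableOn (fun x : V => x) S μ :=
    continuous_id.continuousOn.integrableOn_compact hcomp
  have hconst : IntegrableOn (fun _ : V => c) S μ :=
    continuous_const.continuousOn.integrableOn_compact hcomp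
  have h := setIntegral_comp_affineEquiv (μ := μ) hcomp hint hf (fun x => x)
  simp_rw [hdecomp] at h
  rw [integral_add (ContinuousLinearMap.integrable_comp _ hid) hconst,
    ContinuousLinearMap.integral_comp_comm _ hid, setIntegral_const] at h
  rw [setAverage_eq, hdecomp, map_smul]
  conv_rhs => rw [← h]
  rw [smul_add, smul_smul, inv_mul_cancel₀ hpos.ne', one_smul]

end Centroid

/-- The signed area of the parallelogram spanned by two complex numbers. -/
def planeArea (v w : ℂ) : ℝ := v.re * w.im - v.im * w.re

theorem planeArea_map (L : ℂ →ₗ[ℝ] ℂ) (v w : ℂ) :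
    planeArea (L v) (L w) = LinearMap.det L * planeArea v w := by
  have h := Complex.basisOneI.det_comp L ![v, w]
  simp only [Module.Basis.det_apply, Matrix.det_fin_two, Module.Basis.toMatrix_apply,
    Complex.coe_basisOneI_repr, Function.comp_apply, Matrix.cons_val_zero,
    Matrix.cons_val_one] at h
  simp only [planeArea]
  linarith

/-- The second moment form of a plane set about its centroid, twisted by the area form so that
it is a quadratic form in `v`. -/
def momentForm (S : Set ℂ) (v : ℂ) : ℝ :=
  ∫ x in S, planeArea v (x - ⨍ y in S, y) ^ 2

variable {S : Set ℂ}

theorem momentForm_linear (hcomp : IsCompact S) (hint : (interior S).Nonempty) {f : ℂ ≃ᵃ[ℝ] ℂ}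
    (hf : f '' S = S) (v : ℂ) : momentForm S (f.linear v) = momentForm S v := by
  rw [momentForm, ← setIntegral_comp_affineEquiv hcomp hint hf, momentForm]
  refine integral_congr_ae (Filter.Eventually.of_forall fun x => ?_)
  have hdet := f.abs_det_linear_eq_one hcomp hint hf
  have hsub : f x - ⨍ y in S, y = f.linear (x - ⨍ y in S, y) := by
    conv_lhs => rw [← apply_average_eq hcomp hint hf]
    exact (f.toAffineMap.linearMap_vsub x _).symm
  simp only [hsub]
  have := planeArea_map (f.linear : ℂ →ₗ[ℝ] ℂ) v (x - ⨍ y in S, y)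
  simp only [LinearEquiv.coe_coe] at this
  rw [this, mul_pow, ← sq_abs (LinearMap.det _), hdet, one_pow, one_mul]

theorem momentForm_pos (hcomp : IsCompact S) (hint : (interior S).Nonempty) {v : ℂ} (hv : v ≠ 0) :
    0 < momentForm S v := by
  set c : ℂ := ⨍ y in S, y
  have hcont : Continuous fun x : ℂ => planeArea v (x - c) ^ 2 := by
    unfold planeArea
    fun_prop
  rw [momentForm, setIntegral_pos_iff_support_of_nonneg_ae
    (Filter.Eventually.of_forall fun x => sq_nonneg _)
    (hcont.continuousOn.integrableOn_compact hcomp)]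
  have hopen : IsOpen (Function.support (fun x : ℂ => planeArea v (x - c) ^ 2) ∩ interior S) :=
    (hcont.isOpen_support).inter isOpen_interior
  refine (hopen.measure_pos volume ?_).trans_le
    (measure_mono (Set.inter_subset_inter_right _ interior_subset))
  obtain ⟨x, hx⟩ := hint
  by_contra hempty
  rw [Set.not_nonempty_iff_eq_empty] at hempty
  have hzero : ∀ y ∈ interior S, planeArea v (y - c) = 0 := by
    intro y hy
    by_contra hne
    exact (hempty ▸ (⟨pow_ne_zero 2 hne, hy⟩ : y ∈ _ ∩ interior S) : y ∈ (∅ : Set ℂ))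
  have hline : Continuous fun t : ℝ => x + t • (Complex.I * v) := by fun_prop
  have hnear : ∀ᶠ t in nhds (0 : ℝ), x + t • (Complex.I * v) ∈ interior S :=
    hline.continuousAt.eventually_mem (isOpen_interior.mem_nhds (by simpa using hx))
  obtain ⟨t, htS, ht⟩ :=
    ((hnear.filter_mono nhdsWithin_le_nhds).and (self_mem_nhdsWithin (s := {0}ᶜ))).exists
  have ht : t ≠ 0 := ht
  have h1 := hzero _ htS
  have h0 := hzero x hx
  simp only [planeArea, Complex.add_re, Complex.add_im, Complex.sub_re, Complex.sub_im,
    Complex.real_smul, Complex.mul_re, Complex.mul_im, Complex.ofReal_re, Complex.ofReal_im,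
    Complex.I_re, Complex.I_im] at h0 h1
  have hsq : t * (v.re * v.re + v.im * v.im) = 0 := by linarith
  have := (mul_eq_zero.1 hsq).resolve_left ht
  exact hv (Complex.normSq_eq_zero.1 this)

theorem exists_momentForm_eq (hcomp : IsCompact S) :
    ∃ A B C : ℝ, ∀ v : ℂ,
      momentForm S v = A * v.re ^ 2 - 2 * B * (v.re * v.im) + C * v.im ^ 2 := by
  set c : ℂ := ⨍ y in S, y with hc
  refine ⟨∫ x in S, (x - c).im ^ 2, ∫ x in S, (x - c).re * (x - c).im,
    ∫ x in S, (x - c).re ^ 2, fun v => ?_⟩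
  have hA : IntegrableOn (fun x : ℂ => (x - c).im ^ 2) S :=
    ContinuousOn.integrableOn_compact hcomp (by fun_prop)
  have hB : IntegrableOn (fun x : ℂ => (x - c).re * (x - c).im) S :=
    ContinuousOn.integrableOn_compact hcomp (by fun_prop)
  have hC : IntegrableOn (fun x : ℂ => (x - c).re ^ 2) S :=
    ContinuousOn.integrableOn_compact hcomp (by fun_prop)
  have hexpand : ∀ x : ℂ, planeArea v (x - c) ^ 2 =
      v.re ^ 2 * (x - c).im ^ 2 - 2 * (v.re * v.im) * ((x - c).re * (x - c).im) +
        v.im ^ 2 * (x - c).re ^ 2 := by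
    intro x
    simp only [planeArea]
    ring
  rw [momentForm]
  simp_rw [← hc, hexpand]
  have hsub : IntegrableOn (fun x : ℂ => v.re ^ 2 * (x - c).im ^ 2 -
      2 * (v.re * v.im) * ((x - c).re * (x - c).im)) S := (hA.const_mul _).sub (hB.const_mul _)
  rw [integral_add hsub (hC.const_mul _), integral_sub (hA.const_mul _) (hB.const_mul _),
    integral_const_mul, integral_const_mul, integral_const_mul]
  ring

/-- A positive definite binary quadratic form is a sum of two squares. -/
theorem exists_linearEquiv_norm_sq {Q : ℂ → ℝ} {A B C : ℝ}
    (hQ : ∀ v : ℂ, Q v = A * v.re ^ 2 - 2 * B * (v.re * v.im) + C * v.im ^ 2)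
    (hpos : ∀ v ≠ 0, 0 < Q v) : ∃ N : ℂ ≃ₗ[ℝ] ℂ, ∀ v, ‖N v‖ ^ 2 = Q v := by
  have hA : 0 < A := by simpa [hQ] using hpos 1 one_ne_zero
  have hD : 0 ≤ C - B ^ 2 / A := by
    have h := hpos ⟨B, A⟩ fun h => hA.ne' (congrArg Complex.im h)
    rw [hQ] at h
    have : 0 < A ^ 2 * (C - B ^ 2 / A) := by
      convert h using 1
      field_simp
      ring
    exact (pos_of_mul_pos_right this (sq_nonneg A)).le
  let N : ℂ →ₗ[ℝ] ℂ :=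
    { toFun := fun v => ⟨√A * (v.re - B / A * v.im), √(C - B ^ 2 / A) * v.im⟩
      map_add' := fun v w => by
        apply Complex.ext <;> simp <;> ring
      map_smul' := fun t v => by
        apply Complex.ext <;> simp <;> ring }
  have hN : ∀ v, ‖N v‖ ^ 2 = Q v := by
    intro v
    rw [Complex.sq_norm, Complex.normSq_apply, hQ]
    change √A * (v.re - B / A * v.im) * (√A * (v.re - B / A * v.im)) +
      √(C - B ^ 2 / A) * v.im * (√(C - B ^ 2 / A) * v.im) = _
    rw [mul_mul_mul_comm, Real.mul_self_sqrt hA.le, mul_mul_mul_comm, Real.mul_self_sqrt hD]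
    field_simp
    ring
  have hinj : Function.Injective N := by
    rw [injective_iff_map_eq_zero]
    intro v hv
    by_contra hne
    have := hpos v hne
    rw [← hN, hv] at this
    simp at this
  exact ⟨LinearEquiv.ofInjectiveEndo N hinj, hN⟩

/-- In suitable coordinates all affine symmetries of a plane convex body are linear isometries. -/
theorem exists_affineEquiv_conj_isometry (hcomp : IsCompact S) (hint : (interior S).Nonempty) :
    ∃ T : ℂ ≃ᵃ[ℝ] ℂ, ∀ f : ℂ ≃ᵃ[ℝ] ℂ, f '' S = S →
      ∃ L : ℂ ≃ₗᵢ[ℝ] ℂ, ∀ x, L (T x) = T (f x) := by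
  obtain ⟨A, B, C, hQ⟩ := exists_momentForm_eq hcomp
  obtain ⟨N, hN⟩ := exists_linearEquiv_norm_sq hQ fun v => momentForm_pos hcomp hint
  set c : ℂ := ⨍ y in S, y
  refine ⟨(AffineEquiv.vaddConst ℝ c).symm.trans N.toAffineEquiv, fun f hf => ?_⟩
  refine ⟨⟨(N.symm.trans f.linear).trans N, fun v => ?_⟩, fun x => ?_⟩
  · refine (pow_left_inj₀ (norm_nonneg _) (norm_nonneg _) two_ne_zero).1 ?_
    change ‖N (f.linear (N.symm v))‖ ^ 2 = _
    rw [hN, momentForm_linear hcomp hint hf, ← hN, N.apply_symm_apply]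
  · have hfc : f c = c := apply_average_eq hcomp hint hf
    change N (f.linear (N.symm (N (x - c)))) = N (f x - c)
    rw [N.symm_apply_apply]
    conv_rhs => rw [← hfc]
    exact congrArg N (f.toAffineMap.linearMap_vsub x c)

theorem exists_affineEquiv_image_eq_closedBall (hcomp : IsCompact S) (hconv : Convex ℝ S)
    (hint : (interior S).Nonempty) (hinf : (Set.extremePoints ℝ S).Infinite)
    (htrans : AutTransitiveOnExtreme S) :
    ∃ T : ℂ ≃ᵃ[ℝ] ℂ, T '' S = Metric.closedBall 0 1 := by
  obtain ⟨T, hT⟩ := exists_affineEquiv_conj_isometry hcomp hint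
  have hTcont : Continuous T := T.toAffineMap.continuous_of_finiteDimensional
  obtain ⟨r, hr, hball⟩ := exists_eq_closedBall_of_isometries (hcomp.image hTcont)
    (hconv.affine_image T.toAffineMap)
    (by rw [← T.image_extremePoints]; exact hinf.image T.injective.injOn) <| by
      intro x hx y hy
      rw [← T.image_extremePoints] at hx hy
      obtain ⟨x, hx, rfl⟩ := hx
      obtain ⟨y, hy, rfl⟩ := hy
      obtain ⟨f, hf, rfl⟩ := htrans x hx y hy
      obtain ⟨L, hL⟩ := hT f hf
      refine ⟨L, ?_, hL x⟩
      conv_rhs => rw [← hf]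
      rw [Set.image_image, Set.image_image]
      exact Set.image_congr fun z _ => hL z
  refine ⟨T.trans (LinearEquiv.smulOfNeZero ℝ ℂ r⁻¹ (inv_ne_zero hr.ne')).toAffineEquiv, ?_⟩
  have hscale : (fun z : ℂ => r⁻¹ • z) '' Metric.closedBall 0 r = Metric.closedBall 0 1 := by
    rw [Set.image_smul, smul_closedBall' (inv_ne_zero hr.ne')]
    simp [abs_of_pos hr, hr.ne']
  rw [← hscale, ← hball, Set.image_image]
  rfl

end Invariants

section Plane

variable {S : Set (EuclideanSpace ℝ (Fin 2))}

/-- If no decomposition uses three distinguishable points, finitely many extreme points cannot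
suffice: the segments between them do not cover an open set. -/
theorem infinite_extremePoints_of_forall_mem_line (hint : (interior S).Nonempty)
    (hline : ∀ x ∈ S, ∃ a ∈ Set.extremePoints ℝ S, ∃ b ∈ Set.extremePoints ℝ S,
      x ∈ affineSpan ℝ {a, b}) : (Set.extremePoints ℝ S).Infinite := by
  intro hfin
  have hnull : MeasureTheory.volume (⋃ a ∈ Set.extremePoints ℝ S, ⋃ b ∈ Set.extremePoints ℝ S,
      (affineSpan ℝ {a, b} : Set (EuclideanSpace ℝ (Fin 2)))) = 0 := by
    refine (MeasureTheory.measure_biUnion_null_iff hfin.countable).2 fun a _ =>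
      (MeasureTheory.measure_biUnion_null_iff hfin.countable).2 fun b _ =>
        MeasureTheory.Measure.addHaar_affineSubspace _ _ fun htop => ?_
    have hle := finrank_vectorSpan_insert_le_set ℝ {b} a
    rw [← direction_affineSpan, htop, AffineSubspace.direction_top, finrank_top,
      finrank_euclideanSpace, vectorSpan_singleton, finrank_bot] at hle
    simp at hle
  refine (MeasureTheory.Measure.measure_pos_of_nonempty_interior MeasureTheory.volume hint).ne'
    (MeasureTheory.measure_mono_null (fun x hx => ?_) hnull)
  obtain ⟨a, ha, b, hb, hx⟩ := hline x hx
  exact Set.mem_biUnion ha (Set.mem_biUnion hb hx)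

theorem exists_mem_line_of_le_two {E : Type*} [NormedAddCommGroup E] [NormedSpace ℝ E]
    {k : ℕ} (hk : 0 < k) (hk2 : k ≤ 2) (s : Fin k → E) {l : Fin k → ℝ} (hl : ∑ j, l j = 1) :
    ∃ i j, ∑ j, l j • s j ∈ affineSpan ℝ {s i, s j} := by
  have hmem : ∑ j, l j • s j ∈ affineSpan ℝ (Set.range s) := by
    rw [← Finset.univ.affineCombination_eq_linear_combination s l hl]
    exact affineCombination_mem_affineSpan hl s
  refine ⟨⟨0, hk⟩, ⟨k - 1, by omega⟩, affineSpan_mono ℝ ?_ hmem⟩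
  rintro _ ⟨i, rfl⟩
  obtain h | h : i = ⟨0, hk⟩ ∨ i = ⟨k - 1, by omega⟩ := by
    simp only [Fin.ext_iff]
    omega
  all_goals simp [h]

theorem affIso_triangle_or_ball (hcomp : IsCompact S) (hconv : Convex ℝ S)
    (hint : (interior S).Nonempty) (htrans : AutTransitiveOnExtreme S)
    (hdec : DistinguishablyDecomposable S) :
    (∃ s : Fin 3 → EuclideanSpace ℝ (Fin 2), AffineIndependent ℝ s ∧
        AffIso S (convexHull ℝ (Set.range s))) ∨
      AffIso S (Metric.closedBall (0 : EuclideanSpace ℝ (Fin 2)) 1) := by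
  by_cases htri : ∃ s : Fin 3 → EuclideanSpace ℝ (Fin 2), (∀ j, s j ∈ S) ∧ Distinguishable S s
  · obtain ⟨s, hs, hdist⟩ := htri
    have hind := hdist.affineIndependent hs
    refine Or.inl ⟨s, hind, AffineMap.id ℝ _, Function.injective_id.injOn, ?_⟩
    rw [← hdist.eq_convexHull hconv hs (hind.affineSpan_eq_top_iff_card_eq_finrank_add_one.2
      (by simp))]
    simp
  · right
    have hinf : (Set.extremePoints ℝ S).Infinite := by
      refine infinite_extremePoints_of_forall_mem_line hint fun x hx => ?_
      obtain ⟨k, s, l, hk, hext, hdist, -, hl, rfl⟩ := hdec x hx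
      have hind := hdist.affineIndependent fun j => (hext j).1
      have hk3 : k ≤ 3 := by
        have h1 := hind.card_le_finrank_succ
        have h2 := Submodule.finrank_le (vectorSpan ℝ (Set.range s))
        rw [finrank_euclideanSpace] at h2
        simp only [Fintype.card_fin] at h1 h2
        omega
      have hk2 : k ≤ 2 := by
        by_contra hlt
        obtain rfl : k = 3 := by omega
        exact htri ⟨s, fun j => (hext j).1, hdist⟩
      obtain ⟨i, j, h⟩ := exists_mem_line_of_le_two hk hk2 s hl
      exact ⟨s i, hext i, s j, hext j, h⟩
    let e : ℂ ≃ₗᵢ[ℝ] EuclideanSpace ℝ (Fin 2) := Complex.orthonormalBasisOneI.repr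
    let g : EuclideanSpace ℝ (Fin 2) ≃ᵃ[ℝ] ℂ := e.symm.toLinearEquiv.toAffineEquiv
    have hgint : (interior (g '' S)).Nonempty := by
      rw [show g '' S = e.symm.toHomeomorph '' S from rfl, ← Homeomorph.image_interior]
      exact hint.image _
    obtain ⟨T, hT⟩ := exists_affineEquiv_image_eq_closedBall (S := g '' S)
      (hcomp.image e.symm.continuous) (hconv.affine_image g.toAffineMap) hgint
      (by rw [← g.image_extremePoints]; exact hinf.image g.injective.injOn) (htrans.image g)
    refine ⟨((g.trans T).trans e.toLinearEquiv.toAffineEquiv).toAffineMap,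
      ((g.trans T).trans e.toLinearEquiv.toAffineEquiv).injective.injOn, ?_⟩
    have hball : e '' Metric.closedBall 0 1 = Metric.closedBall 0 1 := by
      simp
    rw [← hball, ← hT, Set.image_image, Set.image_image]
    rfl

end Plane

/-- Theorem: a compact convex `S ⊆ ℝ²` with full affine hull is affinely isomorphic to a
triangle or to the closed unit disk iff its affine automorphism group acts transitively on
extreme points and `S` is distinguishably decomposable. -/
theorem two_dimensional_strongly_symmetric (S : Set (EuclideanSpace ℝ (Fin 2)))
    (hScompact : IsCompact S) (hSconvex : Convex ℝ S)
    (hspan : affineSpan ℝ S = ⊤) :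
    ((∃ s : Fin 3 → EuclideanSpace ℝ (Fin 2), AffineIndependent ℝ s ∧
        AffIso S (convexHull ℝ (Set.range s))) ∨
     AffIso S (Metric.closedBall (0 : EuclideanSpace ℝ (Fin 2)) 1)) ↔
      (AutTransitiveOnExtreme S ∧ DistinguishablyDecomposable S) := by
  have hint : (interior S).Nonempty := hSconvex.interior_nonempty_iff_affineSpan_eq_top.2 hspan
  constructor
  · rintro (⟨s, hs, h⟩ | h)
    · obtain ⟨g, hg⟩ := h.exists_affineEquiv hint rfl
      let b : AffineBasis (Fin 3) ℝ (EuclideanSpace ℝ (Fin 2)) :=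
        ⟨s, hs, hs.affineSpan_eq_top_iff_card_eq_finrank_add_one.2 (by simp)⟩
      rw [← g.symm_image_image S, hg]
      exact ⟨b.autTransitiveOnExtreme_convexHull.image g.symm,
        b.distinguishablyDecomposable_convexHull.image g.symm⟩
    · obtain ⟨g, hg⟩ := h.exists_affineEquiv hint rfl
      rw [← g.symm_image_image S, hg]
      exact ⟨autTransitiveOnExtreme_closedBall.image g.symm,
        distinguishablyDecomposable_closedBall.image g.symm⟩
  · rintro ⟨htrans, hdec⟩
    exact affIso_triangle_or_ball hScompact hSconvex hint htrans hdec
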